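/- Let the closed unit disk D be partitioned into two regions A, B whose closures are homeomorphic to D, with A ∪ B = D and A, B disjoint. Then max(|∂A|, |∂B|) ≥ π + 2, where |∂A| denotes the length (1-dimensional measure) of the boundary of A. Equality holds when A and B are complementary half-disks. -/

import Mathlib

open MeasureTheory Metric

noncomputable section

/-- The closed unit disk in the Euclidean plane. -/
def unitDisk : Set (EuclideanSpace ℝ (Fin 2)) := closedBall 0 1

/-- The left half-disk. -/
def leftHalf : Set (EuclideanSpace ℝ (Fin 2)) := {p | ‖p‖ ≤ 1 ∧ p 0 ≤ 0}

/-- The right half-disk (open on the dividing diameter). -/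
def rightHalf : Set (EuclideanSpace ℝ (Fin 2)) := {p | ‖p‖ ≤ 1 ∧ 0 < p 0}

/-- Continuous logarithms exist for nonvanishing functions on a real normed space. -/
lemma dp_lift {E : Type*} [NormedAddCommGroup E] [NormedSpace ℝ E] (f : E → ℂ)
    (hf : Continuous f) (h0 : ∀ x, f x ≠ 0) :
    ∃ g : E → ℂ, Continuous g ∧ ∀ x, Complex.exp (g x) = f x := by
  have hs : SimplyConnectedSpace E := inferInstance
  obtain ⟨F, ⟨-, hF⟩, -⟩ := Complex.isCoveringMapOn_exp.existsUnique_continuousMap_lifts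
    (⟨f, hf⟩ : C(E, ℂ)) (a₀ := 0) (Complex.exp_log (h0 0)) (fun a => h0 a)
  exact ⟨F, F.continuous, fun x => congrFun hF x⟩

/-- Two continuous logarithms of one function differ by a constant. -/
lemma dp_const {X : Type*} [TopologicalSpace X] {S : Set X} (hS : IsPreconnected S)
    {u v : X → ℂ} (hu : ContinuousOn u S) (hv : ContinuousOn v S)
    (h : ∀ x ∈ S, Complex.exp (u x) = Complex.exp (v x)) {x y : X} (hx : x ∈ S) (hy : y ∈ S) :
    u x - v x = u y - v y := by
  have hc : (Set.range (fun n : ℤ => (n : ℂ) * (2 * Real.pi * Complex.I))).Countable :=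
    Set.countable_range _
  have himg := hS.image _ (hu.sub hv)
  refine hc.isTotallyDisconnected _ ?_ himg (Set.mem_image_of_mem _ hx) (Set.mem_image_of_mem _ hy)
  rintro _ ⟨z, hz, rfl⟩
  obtain ⟨n, hn⟩ := Complex.exp_eq_exp_iff_exists_int.1 (h z hz)
  exact ⟨n, by simp [hn]⟩

lemma dp_const' {u v : ℝ → ℂ} (hu : Continuous u) (hv : Continuous v)
    (h : ∀ x, Complex.exp (u x) = Complex.exp (v x)) (x y : ℝ) :
    u x - v x = u y - v y :=
  dp_const isPreconnected_univ hu.continuousOn hv.continuousOn (fun x _ => h x)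
    (Set.mem_univ _) (Set.mem_univ _)

/-- Points of the unit circle by angle. -/
def dpE (t : ℝ) : ℂ := Complex.exp (t * Complex.I)

lemma dpE_norm (t : ℝ) : ‖dpE t‖ = 1 := Complex.norm_exp_ofReal_mul_I t
lemma dpE_ne (t : ℝ) : dpE t ≠ 0 := Complex.exp_ne_zero _
lemma dpE_cont : Continuous dpE := by unfold dpE; fun_prop
lemma dpE_div (s t : ℝ) : dpE s / dpE t = dpE (s - t) := by
  unfold dpE; rw [← Complex.exp_sub]; congr 1; push_cast; ring
lemma dpE_add (s t : ℝ) : dpE (s + t) = dpE s * dpE t := by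
  unfold dpE; rw [← Complex.exp_add]; congr 1; push_cast; ring
lemma dpE_pi : dpE Real.pi = -1 := Complex.exp_pi_mul_I
lemma dpE_two_pi : dpE (2 * Real.pi) = 1 := by
  unfold dpE; push_cast; exact Complex.exp_two_pi_mul_I
lemma dpE_add_two_pi (t : ℝ) : dpE (t + 2 * Real.pi) = dpE t := by
  rw [dpE_add, dpE_two_pi, mul_one]
lemma dpE_zero : dpE 0 = 1 := by simp [dpE]

/-- `1 - e^{iθ} = 2 sin(θ/2) e^{i(θ-π)/2}`. -/
lemma dp_one_sub (θ : ℝ) :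
    1 - dpE θ = ((2 * Real.sin (θ / 2) : ℝ) : ℂ) * dpE ((θ - Real.pi) / 2) := by
  have h1 : dpE ((θ - Real.pi) / 2) = dpE (θ / 2) * (-Complex.I) := by
    rw [show (θ - Real.pi) / 2 = θ / 2 + (-(Real.pi / 2)) by ring, dpE_add]
    congr 1
    unfold dpE
    rw [Complex.exp_mul_I, ← Complex.ofReal_cos, ← Complex.ofReal_sin]
    simp
  have h2 : dpE θ = dpE (θ / 2) * dpE (θ / 2) := by rw [← dpE_add]; congr 1; ring
  have h3 : dpE (θ / 2) = (Real.cos (θ / 2) : ℂ) + Real.sin (θ / 2) * Complex.I := by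
    unfold dpE
    rw [Complex.exp_mul_I, ← Complex.ofReal_cos, ← Complex.ofReal_sin]
  have h4 : ((Real.cos (θ / 2) : ℂ)) ^ 2 + (Real.sin (θ / 2) : ℂ) ^ 2 = 1 := by
    exact_mod_cast Real.cos_sq_add_sin_sq (θ / 2)
  rw [h1, h2, h3]
  simp only [Complex.ofReal_mul, Complex.ofReal_ofNat]
  linear_combination (-1 : ℂ) * h4 +
    ((Real.sin (θ / 2) : ℂ)) ^ 2 * Complex.I_sq

lemma dp_arg (θ : ℝ) (h0 : 0 < θ) (h1 : θ < 2 * Real.pi) :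
    (Complex.log (1 - dpE θ)).im = (θ - Real.pi) / 2 := by
  rw [Complex.log_im, dp_one_sub, Complex.arg_real_mul]
  · unfold dpE
    rw [Complex.arg_exp_mul_I, toIocMod_eq_self]
    constructor <;> linarith
  · have := Real.sin_pos_of_pos_of_lt_pi (x := θ / 2) (by linarith) (by linarith)
    linarith

lemma dp_arg' (θ : ℝ) (h0 : 0 < θ) (h1 : θ < 2 * Real.pi) :
    (Complex.log (1 - dpE (-θ))).im = -((θ - Real.pi) / 2) := by
  have : dpE (-θ) = dpE (2 * Real.pi - θ) := by
    rw [← dpE_add_two_pi]; congr 1; ring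
  rw [this, dp_arg] <;> linarith

lemma dp_dist (s t : ℝ) (h : s ≤ t) (h' : t ≤ s + 2 * Real.pi) :
    ‖dpE s - dpE t‖ = 2 * Real.sin ((t - s) / 2) := by
  have : dpE s - dpE t = dpE s * (1 - dpE (t - s)) := by
    rw [mul_sub, mul_one, ← dpE_add]; congr 2; ring
  rw [this, norm_mul, dpE_norm, dp_one_sub, norm_mul, dpE_norm, one_mul, mul_one,
    Complex.norm_real, Real.norm_eq_abs, abs_of_nonneg]
  have := Real.sin_nonneg_of_nonneg_of_le_pi (x := (t - s) / 2) (by linarith) (by linarith)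
  linarith

lemma dp_slit {w z : ℂ} (hw : ‖w‖ = 1) (hz : ‖z‖ ≤ 1) (h : z ≠ w) :
    1 - z / w ∈ Complex.slitPlane := by
  left
  have hn : ‖z / w‖ ≤ 1 := by rw [norm_div, hw, div_one]; exact hz
  have hw0 : w ≠ 0 := by intro h; simp [h] at hw
  have hne : z / w ≠ 1 := by
    intro h'; exact h (by rwa [div_eq_one_iff_eq hw0] at h')
  have hsq : (z / w).re ^ 2 + (z / w).im ^ 2 ≤ 1 := by
    have h1 := Complex.sq_norm (z / w)
    rw [Complex.normSq_apply] at h1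
    nlinarith [norm_nonneg (z / w)]
  rw [Complex.sub_re, Complex.one_re]
  by_contra hcon
  push Not at hcon
  have hre : (z / w).re = 1 := by nlinarith [sq_nonneg (z / w).im]
  have him : (z / w).im = 0 := by
    have : (z / w).im ^ 2 ≤ 0 := by nlinarith
    exact pow_eq_zero_iff (two_ne_zero) |>.1 (le_antisymm this (sq_nonneg _))
  exact hne (Complex.ext (by simpa using hre) (by simpa using him))

/-- logarithm increments along a side of the square -/
lemma dp_side {w c : ℂ} (hc : c ≠ 0) (hw : ‖w‖ = 1) {β g : ℝ → ℂ} (hβ : Continuous β)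
    (hg : Continuous g)
    (hb : ∀ t, ‖β t‖ ≤ 1) (hne : ∀ t, β t ≠ w) (h : ∀ t, Complex.exp (g t) = c * (1 - β t / w)) :
    g 1 - g 0 = Complex.log (1 - β 1 / w) - Complex.log (1 - β 0 / w) := by
  have hs : ∀ t, 1 - β t / w ∈ Complex.slitPlane := fun t => dp_slit hw (hb t) (hne t)
  have := dp_const' (u := g) (v := fun t => Complex.log c + Complex.log (1 - β t / w)) hg
    (continuous_const.add (Continuous.clog (by fun_prop) hs)) (fun t => by
      rw [h, Complex.exp_add, Complex.exp_log hc, Complex.exp_log (Complex.slitPlane_ne_zero (hs t))])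
    1 0
  linear_combination this

/-- Two paths in the disk joining alternating boundary points meet. -/
lemma dp_cross {t1 t2 t3 t4 : ℝ} (h12 : t1 < t2) (h23 : t2 < t3) (h34 : t3 < t4)
    (h41 : t4 < t1 + 2 * Real.pi) {α β : ℝ → ℂ} (hα : Continuous α) (hβ : Continuous β)
    (hα1 : ∀ s, ‖α s‖ ≤ 1) (hβ1 : ∀ s, ‖β s‖ ≤ 1) (a0 : α 0 = dpE t1) (a1 : α 1 = dpE t3)
    (b0 : β 0 = dpE t2) (b1 : β 1 = dpE t4) : ∃ s t, α s = β t := by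
  by_contra hcon
  push Not at hcon
  obtain ⟨G, hG, hGe⟩ := dp_lift (E := ℝ × ℝ) (fun p => α p.1 - β p.2) (by fun_prop)
    (fun p => sub_ne_zero.2 (hcon _ _))
  have e1 := dp_side (dpE_ne t1) (dpE_norm t1) hβ (g := fun t => G (0, t)) (by fun_prop) hβ1
    (fun t => by rw [← a0]; exact (hcon _ _).symm)
    (fun t => by rw [hGe, mul_sub, mul_div_cancel₀ _ (dpE_ne _)]; simp [a0])
  have e3 := dp_side (dpE_ne t3) (dpE_norm t3) hβ (g := fun t => G (1, t)) (by fun_prop) hβ1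
    (fun t => by rw [← a1]; exact (hcon _ _).symm)
    (fun t => by rw [hGe, mul_sub, mul_div_cancel₀ _ (dpE_ne _)]; simp [a1])
  have e2 := dp_side (neg_ne_zero.2 (dpE_ne t2)) (dpE_norm t2) hα (g := fun t => G (t, 0))
    (by fun_prop) hα1 (fun t => by rw [← b0]; exact (hcon _ _))
    (fun t => by rw [hGe, neg_mul, mul_sub, mul_div_cancel₀ _ (dpE_ne _)]; simp [b0])
  have e4 := dp_side (neg_ne_zero.2 (dpE_ne t4)) (dpE_norm t4) hα (g := fun t => G (t, 1))
    (by fun_prop) hα1 (fun t => by rw [← b1]; exact (hcon _ _))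
    (fun t => by rw [hGe, neg_mul, mul_sub, mul_div_cancel₀ _ (dpE_ne _)]; simp [b1])
  simp only [a0, a1, b0, b1, dpE_div] at e1 e2 e3 e4
  have key := congrArg Complex.im (show
    (Complex.log (1 - dpE (t4 - t1)) - Complex.log (1 - dpE (t2 - t1))) +
    (Complex.log (1 - dpE (t3 - t4)) - Complex.log (1 - dpE (t1 - t4))) =
    (Complex.log (1 - dpE (t3 - t2)) - Complex.log (1 - dpE (t1 - t2))) +
    (Complex.log (1 - dpE (t4 - t3)) - Complex.log (1 - dpE (t2 - t3))) by
      rw [← e1, ← e2, ← e3, ← e4]; ring)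
  simp only [Complex.add_im, Complex.sub_im] at key
  rw [← neg_sub t4 t3, ← neg_sub t4 t1, ← neg_sub t2 t1, ← neg_sub t3 t2,
    dp_arg (t4 - t1) (by linarith) (by linarith), dp_arg (t2 - t1) (by linarith) (by linarith), dp_arg (t3 - t2) (by linarith) (by linarith), dp_arg (t4 - t3) (by linarith) (by linarith),
    dp_arg' (t4 - t3) (by linarith) (by linarith), dp_arg' (t4 - t1) (by linarith) (by linarith), dp_arg' (t2 - t1) (by linarith) (by linarith), dp_arg' (t3 - t2) (by linarith) (by linarith)] at key
  have := Real.pi_pos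
  linarith


/-- The radial retraction onto the closed unit disk. -/
def dpR (x : ℂ) : ℂ := x / ((max 1 ‖x‖ : ℝ) : ℂ)

lemma dpR_cont : Continuous dpR := by
  unfold dpR
  refine continuous_id.div (by fun_prop) (fun x => ?_)
  have : (0 : ℝ) < max 1 ‖x‖ := lt_of_lt_of_le one_pos (le_max_left _ _)
  exact_mod_cast this.ne'

lemma dpR_mem (x : ℂ) : dpR x ∈ closedBall (0 : ℂ) 1 := by
  have h : (0 : ℝ) < max 1 ‖x‖ := lt_of_lt_of_le one_pos (le_max_left _ _)
  rw [mem_closedBall_zero_iff, dpR, norm_div, Complex.norm_real, Real.norm_eq_abs, abs_of_pos h,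
    div_le_one h]
  exact le_max_right _ _

lemma dpR_eq {x : ℂ} (hx : x ∈ closedBall (0 : ℂ) 1) : dpR x = x := by
  rw [mem_closedBall_zero_iff] at hx
  simp [dpR, max_eq_left hx]

lemma dpR_comp {f : ℂ → ℂ} (hf : ContinuousOn f (closedBall 0 1)) :
    Continuous (fun x => f (dpR x)) :=
  hf.comp_continuous dpR_cont dpR_mem

/-- The closed disk is unicoherent. -/
lemma dp_unicoherent {K L : Set ℂ} (hK : IsClosed K) (hL : IsClosed L) (hKc : IsPreconnected K)
    (hLc : IsPreconnected L) (hU : K ∪ L = closedBall 0 1) : IsPreconnected (K ∩ L) := by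
  classical
  have hC : IsClosed (K ∩ L) := hK.inter hL
  rw [isPreconnected_iff_subset_of_disjoint_closed]
  intro u v hu hv hsub hdis
  by_contra hcon
  push Not at hcon
  obtain ⟨h1, h2⟩ := hcon
  obtain ⟨c2, hc2, hc2u⟩ := Set.not_subset.1 h1
  obtain ⟨c1, hc1, hc1v⟩ := Set.not_subset.1 h2
  have hc2v : c2 ∈ v := (hsub hc2).resolve_left hc2u
  have hc1u : c1 ∈ u := (hsub hc1).resolve_right hc1v
  have hd : Disjoint (K ∩ L ∩ u) (K ∩ L ∩ v) := by
    rw [Set.disjoint_left]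
    rintro x ⟨hx, hxu⟩ ⟨-, hxv⟩
    have : x ∈ K ∩ L ∩ (u ∩ v) := ⟨hx, hxu, hxv⟩
    rw [hdis] at this
    exact this
  obtain ⟨φ, hφ0, hφ1, -⟩ := exists_continuous_zero_one_of_isClosed (hC.inter hu) (hC.inter hv) hd
  have hφ : Continuous φ := φ.continuous
  let a : ℂ → ℂ := fun x => (Real.pi * φ x : ℝ) * Complex.I
  have ha : Continuous a := by fun_prop
  let f : ℂ → ℂ := fun x => if x ∈ K then Complex.exp (a x) else Complex.exp (-a x)
  have hfK : ∀ x ∈ K, f x = Complex.exp (a x) := fun x hx => if_pos hx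
  have hfL : ∀ x ∈ L, f x = Complex.exp (-a x) := by
    intro x hx
    by_cases hxK : x ∈ K
    · rw [hfK x hxK]
      rcases hsub ⟨hxK, hx⟩ with h | h
      · have : φ x = 0 := hφ0 ⟨⟨hxK, hx⟩, h⟩
        simp [a, this]
      · have : φ x = 1 := hφ1 ⟨⟨hxK, hx⟩, h⟩
        simp [a, this, Complex.exp_neg]
    · exact if_neg hxK
  have hfc : ContinuousOn f (closedBall 0 1) := by
    rw [← hU]
    refine ContinuousOn.union_of_isClosed ?_ ?_ hK hL
    · exact (Continuous.continuousOn (by fun_prop)).congr hfK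
    · exact (Continuous.continuousOn (by fun_prop)).congr hfL
  obtain ⟨g, hg, hge⟩ := dp_lift _ (dpR_comp hfc) (fun x => by
    simp only [f]; split_ifs <;> exact Complex.exp_ne_zero _)
  have hge' : ∀ x ∈ closedBall (0 : ℂ) 1, Complex.exp (g x) = f x := by
    intro x hx; rw [hge, dpR_eq hx]
  have k1 := dp_const hKc hg.continuousOn ha.continuousOn
    (fun x hx => by rw [hge' x (hU ▸ Or.inl hx), hfK x hx]) hc1.1 hc2.1
  have k2 := dp_const hLc hg.continuousOn ha.neg.continuousOn
    (fun x hx => by rw [hge' x (hU ▸ Or.inr hx), hfL x hx]; rfl) hc1.2 hc2.2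
  have z1 : φ c1 = 0 := hφ0 ⟨hc1, hc1u⟩
  have z2 : φ c2 = 1 := hφ1 ⟨hc2, hc2v⟩
  simp only [a, z1, z2, Pi.neg_apply] at k1 k2
  have : (Real.pi : ℂ) * Complex.I = 0 := by
    push_cast at k1 k2
    linear_combination (1 / 2 : ℂ) * (k1 - k2)
  simp [Real.pi_ne_zero] at this

/-- Invariance of domain at the centre. -/
lemma dp_inv0 {h : ℂ → ℂ} (hc : ContinuousOn h (closedBall 0 1))
    (hi : Set.InjOn h (closedBall 0 1)) : h 0 ∈ interior (h '' closedBall 0 1) := by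
  by_contra hcon
  have hE : ∀ t, dpE t ∈ closedBall (0 : ℂ) 1 := fun t => by
    rw [mem_closedBall_zero_iff, dpE_norm]
  have h00 : (0 : ℂ) ∈ closedBall (0 : ℂ) 1 := by simp
  have hsph : sphere (0 : ℂ) 1 ⊆ closedBall 0 1 := sphere_subset_closedBall
  -- the minimal distance
  obtain ⟨x0, hx0, hmin⟩ := (isCompact_sphere (0 : ℂ) 1).exists_isMinOn
    ⟨dpE 0, by simp [dpE_norm]⟩ (f := fun x => ‖h x - h 0‖)
    ((hc.mono hsph).sub continuousOn_const).norm
  have hpos : 0 < ‖h x0 - h 0‖ := by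
    rw [norm_pos_iff, sub_ne_zero]
    intro heq
    have := hi (hsph hx0) h00 heq
    rw [this] at hx0
    simp at hx0
  obtain ⟨q, hq, hqn⟩ : ∃ q, ‖q - h 0‖ < ‖h x0 - h 0‖ ∧ q ∉ h '' closedBall 0 1 := by
    by_contra hno
    push Not at hno
    refine hcon (mem_interior_iff_mem_nhds.2 (Metric.mem_nhds_iff.2 ⟨_, hpos, ?_⟩))
    intro q hq
    exact hno q (by rwa [mem_ball, dist_eq_norm] at hq)
  have hR := dpR_comp hc
  obtain ⟨H, hH, hHe⟩ := dp_lift (fun x => h (dpR x) - q) (hR.sub continuous_const) (fun x hx => by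
    exact hqn ⟨_, dpR_mem x, sub_eq_zero.1 hx⟩)
  -- the homotopy
  let cl : ℝ → ℝ := fun t => max 0 (min t 1)
  have hcl : Continuous cl := by fun_prop
  have hcl0 : ∀ t, 0 ≤ cl t := fun t => le_max_left _ _
  have hcl1 : ∀ t, cl t ≤ 1 := fun t => max_le zero_le_one (min_le_right _ _)
  have hmem : ∀ s t, -(cl t : ℂ) * dpE s ∈ closedBall (0 : ℂ) 1 := fun s t => by
    rw [mem_closedBall_zero_iff, norm_mul, dpE_norm, norm_neg, Complex.norm_real,
      Real.norm_eq_abs, abs_of_nonneg (hcl0 t), mul_one]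
    exact hcl1 t
  have hEc := dpE_cont
  obtain ⟨G, hG, hGe⟩ := dp_lift (E := ℝ × ℝ)
    (fun p => h (dpR (dpE p.1)) - h (dpR (-(cl p.2 : ℂ) * dpE p.1)))
    (by
      refine Continuous.sub ?_ ?_
      · exact hR.comp (by fun_prop)
      · exact hR.comp (g := fun x => h (dpR x))
          (f := fun p : ℝ × ℝ => -(cl p.2 : ℂ) * dpE p.1) (by fun_prop))
    (fun p hp => by
      rw [dpR_eq (hE _), dpR_eq (hmem _ _)] at hp
      have h1 := hi (hE _) (hmem _ _) (sub_eq_zero.1 hp)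
      have h2 : ((1 + cl p.2 : ℝ) : ℂ) * dpE p.1 = 0 := by
        push_cast; linear_combination h1
      rcases mul_eq_zero.1 h2 with h3 | h3
      · have h4 : (1 + cl p.2 : ℝ) = 0 := by exact_mod_cast h3
        linarith [hcl0 p.2]
      · exact dpE_ne _ h3)
  have hGe' : ∀ s t, Complex.exp (G (s, t)) = h (dpE s) - h (-(cl t : ℂ) * dpE s) := by
    intro s t
    rw [hGe, dpR_eq (hE _), dpR_eq (hmem _ _)]
  have c0 : cl 0 = 0 := by simp [cl]
  have c1 : cl 1 = 1 := by simp [cl]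
  have hlow : ∀ s, ‖h x0 - h 0‖ ≤ ‖h (dpE s) - h 0‖ := fun s => hmin (by simp [dpE_norm])
  have hne : ∀ s, h (dpE s) - h 0 ≠ 0 := fun s => norm_pos_iff.1 (hpos.trans_le (hlow s))
  have hsl : ∀ s, (h (dpE s) - q) / (h (dpE s) - h 0) ∈ Complex.slitPlane := by
    intro s
    have e : (h (dpE s) - q) / (h (dpE s) - h 0) = 1 - (q - h 0) / (h (dpE s) - h 0) := by
      field_simp [hne s]
      ring
    rw [e]
    refine dp_slit (w := 1) (z := (q - h 0) / (h (dpE s) - h 0)) (by simp) ?_ ?_ |> fun h => by simpa using h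
    · rw [norm_div]
      exact div_le_one_of_le₀ (hq.le.trans (hlow s)) (norm_nonneg _)
    · intro h1
      have := congrArg norm h1
      rw [norm_div, norm_one, div_eq_one_iff_eq (norm_ne_zero_iff.2 (hne s))] at this
      linarith [hlow s]
  have hhc : Continuous fun s => h (dpE s) := hc.comp_continuous dpE_cont hE
  -- periodicity at time zero
  have p0 := dp_const' (u := fun s => G (s, 0))
    (v := fun s => H (dpE s) - Complex.log ((h (dpE s) - q) / (h (dpE s) - h 0)))
    (by fun_prop)
    ((hH.comp dpE_cont).sub (Continuous.clog
      ((hhc.sub continuous_const).div (hhc.sub continuous_const) hne) hsl))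
    (fun s => by
      have hn1 : h (dpE s) - q ≠ 0 := fun hx => hqn ⟨_, hE s, sub_eq_zero.1 hx⟩
      rw [hGe', Complex.exp_sub, hHe, Complex.exp_log (Complex.slitPlane_ne_zero (hsl s)), c0,
        dpR_eq (hE s)]
      field_simp [hne s]
      simp)
    (2 * Real.pi) 0
  simp only [dpE_two_pi, dpE_zero] at p0
  have p1 := dp_const' (u := fun t => G (2 * Real.pi, t)) (v := fun t => G (0, t))
    (by fun_prop) (by fun_prop) (fun t => by rw [hGe', hGe', dpE_two_pi, dpE_zero]) 0 1
  have hodd : ∀ s, Complex.exp (G (s + Real.pi, 1)) = Complex.exp (G (s, 1) + Real.pi * Complex.I) := by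
    intro s
    rw [Complex.exp_add, Complex.exp_pi_mul_I, hGe', hGe', dpE_add, dpE_pi, c1]
    simp
  have p2 := dp_const' (u := fun s => G (s + Real.pi, 1))
    (v := fun s => G (s, 1) + Real.pi * Complex.I) (by fun_prop) (by fun_prop) hodd 0 Real.pi
  simp only [zero_add] at p2
  have e2 := hodd 0
  rw [zero_add, show Real.pi + Real.pi = 2 * Real.pi by ring] at *
  have e3 : G (Real.pi, 1) = G (0, 1) := by linear_combination (1 / 2 : ℂ) * (p2 + p0 - p1)
  rw [e3, Complex.exp_add, Complex.exp_pi_mul_I] at e2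
  have := Complex.exp_ne_zero (G (0, 1))
  have h2 : (2 : ℂ) * Complex.exp (G (0, 1)) = 0 := by linear_combination e2
  simp at h2

lemma dp_inv {h : ℂ → ℂ} (hc : ContinuousOn h (closedBall 0 1))
    (hi : Set.InjOn h (closedBall 0 1)) : IsOpen (h '' ball 0 1) := by
  rw [isOpen_iff_mem_nhds]
  rintro _ ⟨z, hz, rfl⟩
  obtain ⟨r, hr, hrs⟩ := Metric.nhds_basis_closedBall.mem_iff.1 (isOpen_ball.mem_nhds hz)
  have hmap : Set.MapsTo (fun x : ℂ => z + r * x) (closedBall 0 1) (closedBall z r) := by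
    intro x hx
    rw [mem_closedBall_zero_iff] at hx
    rw [mem_closedBall, dist_eq_norm, add_sub_cancel_left, norm_mul, Complex.norm_real,
      Real.norm_eq_abs, abs_of_pos hr]
    nlinarith
  have hmap' : Set.MapsTo (fun x : ℂ => z + r * x) (closedBall 0 1) (ball 0 1) :=
    fun x hx => hrs (hmap hx)
  have hsub : ball (0 : ℂ) 1 ⊆ closedBall 0 1 := ball_subset_closedBall
  have key := dp_inv0 (h := fun x => h (z + r * x))
    (hc.comp (Continuous.continuousOn (by fun_prop)) (hmap'.mono_right hsub))
    (fun x hx y hy hxy => by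
      have := hi (hsub (hmap' hx)) (hsub (hmap' hy)) hxy
      have hr' : (r : ℂ) ≠ 0 := by exact_mod_cast hr.ne'
      simpa [hr'] using this)
  simp only [mul_zero, add_zero] at key
  refine Filter.mem_of_superset (mem_interior_iff_mem_nhds.1 key) ?_
  rintro _ ⟨x, hx, rfl⟩
  exact ⟨_, hmap' hx, rfl⟩


/-- Facts about closed topological disks in the plane. -/
lemma dp_disk {K : Set ℂ} (e : K ≃ₜ closedBall (0 : ℂ) 1) :
    IsCompact K ∧ IsPreconnected K ∧
      ∃ U : Set ℂ, IsOpen U ∧ IsPathConnected U ∧ U ⊆ K ∧ K ⊆ closure U := by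
  let h : ℂ → ℂ := fun x => (e.symm ⟨dpR x, dpR_mem x⟩ : ℂ)
  have hh : Continuous h := by
    have := dpR_cont
    fun_prop
  have hi : Set.InjOn h (closedBall 0 1) := by
    intro x hx y hy hxy
    have h1 := e.symm.injective (Subtype.ext hxy)
    have h2 := congrArg Subtype.val h1
    simpa [dpR_eq hx, dpR_eq hy] using h2
  have himg : h '' closedBall 0 1 = K := by
    ext z
    constructor
    · rintro ⟨x, -, rfl⟩
      exact (e.symm _).2
    · intro hz
      refine ⟨e ⟨z, hz⟩, (e ⟨z, hz⟩).2, ?_⟩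
      simp only [h]
      have : (⟨dpR (e ⟨z, hz⟩ : ℂ), dpR_mem _⟩ : closedBall (0 : ℂ) 1) = e ⟨z, hz⟩ :=
        Subtype.ext (dpR_eq (e ⟨z, hz⟩).2)
      rw [this, e.symm_apply_apply]
  refine ⟨?_, ?_, h '' ball 0 1, dp_inv hh.continuousOn hi, ?_, ?_, ?_⟩
  · rw [← himg]; exact (isCompact_closedBall _ _).image hh
  · rw [← himg]
    exact (convex_closedBall (0 : ℂ) 1).isPreconnected.image _ hh.continuousOn
  · exact ((convex_ball (0 : ℂ) 1).isPathConnected ⟨0, by simp⟩).image hh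
  · rw [← himg]; exact Set.image_mono ball_subset_closedBall
  · rw [← himg, ← closure_ball (0 : ℂ) one_ne_zero]
    exact image_closure_subset_closure_image hh

lemma dp_near {U N : Set ℂ} {x : ℂ} (hx : x ∈ closure U) (hxD : x ∈ closedBall (0 : ℂ) 1)
    (hU : U ⊆ closedBall 0 1) (hN : N ∈ nhds x) :
    ∃ u ∈ U, JoinedIn (N ∩ closedBall 0 1) x u := by
  obtain ⟨ε, hε, hsub⟩ := Metric.mem_nhds_iff.1 hN
  obtain ⟨u, huU, hu⟩ := Metric.mem_closure_iff.1 hx ε hε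
  refine ⟨u, huU, JoinedIn.of_segment_subset ?_⟩
  refine (((convex_ball x ε).inter (convex_closedBall (0 : ℂ) 1)).segment_subset
    ⟨mem_ball_self hε, hxD⟩ ⟨by rwa [mem_ball, dist_comm], hU huU⟩).trans ?_
  exact Set.inter_subset_inter_left _ hsub

/-- Boundary points of the two regions do not alternate. -/
lemma dp_sep {K L U V : Set ℂ} (hL : IsClosed L) (hU : K ∪ L = closedBall 0 1)
    (hUo : IsOpen U) (hUp : IsPathConnected U) (hUK : U ⊆ K) (hKU : K ⊆ closure U)
    (hVp : IsPathConnected V) (hVL : V ⊆ L) (hLV : L ⊆ closure V)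
    (hd : Disjoint U V) {t1 t2 t3 t4 : ℝ} (h12 : t1 < t2) (h23 : t2 < t3) (h34 : t3 < t4)
    (h41 : t4 < t1 + 2 * Real.pi) (h1 : dpE t1 ∉ L) (h3 : dpE t3 ∉ L)
    (h2 : dpE t2 ∈ L) (h4 : dpE t4 ∈ L) : False := by
  have hE : ∀ t, dpE t ∈ closedBall (0 : ℂ) 1 := fun t => by
    rw [mem_closedBall_zero_iff, dpE_norm]
  have hKD : K ⊆ closedBall 0 1 := hU ▸ Set.subset_union_left
  have hLD : L ⊆ closedBall 0 1 := hU ▸ Set.subset_union_right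
  have hUL : Disjoint U L := (hd.closure_right hUo).mono_right hLV
  have hK' : ∀ t, dpE t ∉ L → dpE t ∈ K := fun t ht => by
    have : dpE t ∈ K ∪ L := hU ▸ hE t
    exact this.resolve_right ht
  -- the first path
  have hsub : Lᶜ ∩ closedBall (0 : ℂ) 1 ⊆ closedBall 0 1 \ L := fun x hx => ⟨hx.2, hx.1⟩
  have hUs : U ⊆ closedBall 0 1 \ L := fun x hx => ⟨hKD (hUK hx), Set.disjoint_left.1 hUL hx⟩
  obtain ⟨u1, hu1, j1⟩ := dp_near (hKU (hK' _ h1)) (hE t1) (hUK.trans hKD)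
    (hL.isOpen_compl.mem_nhds h1)
  obtain ⟨u3, hu3, j3⟩ := dp_near (hKU (hK' _ h3)) (hE t3) (hUK.trans hKD)
    (hL.isOpen_compl.mem_nhds h3)
  have J : JoinedIn (closedBall (0 : ℂ) 1 \ L) (dpE t1) (dpE t3) :=
    ((j1.mono hsub).trans ((hUp.joinedIn u1 hu1 u3 hu3).mono hUs)).trans (j3.mono hsub).symm
  let α := J.somePath
  have hα : ∀ s, α s ∈ closedBall (0 : ℂ) 1 \ L := J.somePath_mem
  have hcl : IsClosed (Set.range α) := (isCompact_range α.continuous).isClosed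
  have hr : ∀ x ∈ L, x ∉ Set.range α := by
    rintro x hx ⟨s, rfl⟩
    exact (hα s).2 hx
  have hsub2 : (Set.range α)ᶜ ∩ closedBall (0 : ℂ) 1 ⊆ closedBall 0 1 \ Set.range α :=
    fun x hx => ⟨hx.2, hx.1⟩
  obtain ⟨v2, hv2, i2⟩ := dp_near (hLV h2) (hE t2) (hVL.trans hLD)
    (hcl.isOpen_compl.mem_nhds (hr _ h2))
  obtain ⟨v4, hv4, i4⟩ := dp_near (hLV h4) (hE t4) (hVL.trans hLD)
    (hcl.isOpen_compl.mem_nhds (hr _ h4))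
  have J' : JoinedIn (closedBall (0 : ℂ) 1 \ Set.range α) (dpE t2) (dpE t4) :=
    ((i2.mono hsub2).trans ((hVp.joinedIn v2 hv2 v4 hv4).mono
      (fun x hx => ⟨hLD (hVL hx), hr x (hVL hx)⟩))).trans (i4.mono hsub2).symm
  let β := J'.somePath
  have hβ : ∀ s, β s ∈ closedBall (0 : ℂ) 1 \ Set.range α := J'.somePath_mem
  obtain ⟨s, t, hst⟩ := dp_cross h12 h23 h34 h41 (α := α.extend) (β := β.extend)
    (by fun_prop) (by fun_prop)
    (fun s => mem_closedBall_zero_iff.1 (hα _).1) (fun s => mem_closedBall_zero_iff.1 (hβ _).1)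
    (by simp) (by simp) (by simp) (by simp)
  exact (hβ _).2 ⟨_, hst⟩

lemma dpE_inj {a s t : ℝ} (hs : s ∈ Set.Ico a (a + 2 * Real.pi))
    (ht : t ∈ Set.Ico a (a + 2 * Real.pi)) (h : dpE s = dpE t) : s = t := by
  obtain ⟨n, hn⟩ := Complex.exp_eq_exp_iff_exists_int.1 h
  have h1 : s = t + n * (2 * Real.pi) := by
    have := congrArg Complex.im hn
    simpa using this
  have hp := Real.pi_pos
  have h2 : (n : ℝ) < 1 := by
    by_contra hc; push Not at hc; nlinarith [hs.1, hs.2, ht.1, ht.2]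
  have h3 : (-1 : ℝ) < n := by
    by_contra hc; push Not at hc; nlinarith [hs.1, hs.2, ht.1, ht.2]
  have h4 : n = 0 := by
    have : n < 1 := by exact_mod_cast h2
    have : -1 < n := by exact_mod_cast h3
    omega
  simpa [h4] using h1

lemma dpE_surj (a : ℝ) {z : ℂ} (hz : ‖z‖ = 1) :
    ∃ t ∈ Set.Ico a (a + 2 * Real.pi), dpE t = z := by
  have hp := Real.two_pi_pos
  refine ⟨toIcoMod hp a z.arg, toIcoMod_mem_Ico hp a _, ?_⟩
  have h1 : dpE z.arg = z := by
    have := Complex.norm_mul_exp_arg_mul_I z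
    rw [hz] at this
    simpa [dpE] using this
  conv_rhs => rw [← h1]
  refine Complex.exp_eq_exp_iff_exists_int.2 ⟨-toIcoDiv hp a z.arg, ?_⟩
  rw [toIcoMod]
  push_cast
  simp
  ring

lemma dpE_lip : LipschitzWith 1 dpE := by
  refine LipschitzWith.of_dist_le_mul (fun s t => ?_)
  have : dpE s - dpE t = dpE s * (1 - dpE (t - s)) := by
    rw [mul_sub, mul_one, ← dpE_add]; congr 2; ring
  rw [dist_eq_norm, this, norm_mul, dpE_norm, dp_one_sub, norm_mul, dpE_norm, one_mul, mul_one,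
    Complex.norm_real, Real.norm_eq_abs, abs_mul, Real.dist_eq]
  have h1 := Real.abs_sin_le_abs (x := (t - s) / 2)
  rw [abs_div] at h1
  rw [abs_sub_comm]
  simp at *
  linarith

lemma dp_arc_le (a b : ℝ) : μH[1] (dpE '' Set.Icc a b) ≤ ENNReal.ofReal (b - a) := by
  have := dpE_lip.hausdorffMeasure_image_le (d := 1) zero_le_one (Set.Icc a b)
  simpa [hausdorffMeasure_real] using this

/-- A preconnected set carrying values of a 1-Lipschitz function. -/
lemma dp_lip_le {S : Set ℂ} {f : ℂ → ℝ} (hf : LipschitzWith 1 f) {d : ℝ}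
    (h : Set.Ioo 0 d ⊆ f '' S) : ENNReal.ofReal d ≤ μH[1] S := by
  have h1 := hf.hausdorffMeasure_image_le (d := 1) zero_le_one S
  simp only [hausdorffMeasure_real, ENNReal.coe_one, ENNReal.one_rpow, one_mul] at h1
  refine le_trans ?_ ((measure_mono h).trans h1)
  simp

lemma dp_arc_small {a b : ℝ} (hab : a ≤ b) (hb : b ≤ a + 2 * Real.pi) :
    ENNReal.ofReal (2 * Real.sin ((b - a) / 2)) ≤ μH[1] (dpE '' Set.Ico a b) := by
  refine dp_lip_le (f := fun z => dist z (dpE a)) (LipschitzWith.dist_left _) ?_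
  intro r hr
  have hc : ContinuousOn (fun t => dist (dpE t) (dpE a)) (Set.Icc a b) := by
    have := dpE_cont
    fun_prop
  have := intermediate_value_Ico hab hc
  simp only [dist_self] at this
  rw [dist_comm (dpE b), dist_eq_norm, dp_dist a b hab hb] at this
  obtain ⟨t, ht, hr⟩ := this ⟨hr.1.le, hr.2⟩
  exact ⟨dpE t, ⟨t, ht, rfl⟩, hr⟩

lemma dp_arc_ge {a b : ℝ} (hab : a ≤ b) (hb : b ≤ a + 2 * Real.pi) :
    ENNReal.ofReal (b - a) ≤ μH[1] (dpE '' Set.Icc a b) := by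
  set l := b - a with hl
  have hl0 : 0 ≤ l := by linarith
  -- additivity
  have hsum : ∀ n : ℕ, ∀ δ : ℝ, 0 ≤ δ → n * δ ≤ 2 * Real.pi →
      n * ENNReal.ofReal (2 * Real.sin (δ / 2)) ≤ μH[1] (dpE '' Set.Ico a (a + n * δ)) := by
    intro n δ hδ
    induction n with
    | zero => simp
    | succ n ih =>
      intro hn
      push_cast at hn ⊢
      have hnδ : 0 ≤ n * δ := by positivity
      have hsplit : Set.Ico a (a + (n + 1) * δ) =
          Set.Ico a (a + n * δ) ∪ Set.Ico (a + n * δ) (a + (n + 1) * δ) := by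
        rw [Set.Ico_union_Ico_eq_Ico] <;> nlinarith
      have hinj : Set.InjOn dpE (Set.Ico (a + n * δ) (a + (n + 1) * δ)) := by
        intro s hs t ht hst
        exact dpE_inj (a := a) ⟨by linarith [hs.1], by linarith [hs.2]⟩
          ⟨by linarith [ht.1], by linarith [ht.2]⟩ hst
      have hmeas : MeasurableSet (dpE '' Set.Ico (a + n * δ) (a + (n + 1) * δ)) :=
        measurableSet_Ico.image_of_continuousOn_injOn dpE_cont.continuousOn hinj
      have hdis : Disjoint (dpE '' Set.Ico a (a + n * δ))
          (dpE '' Set.Ico (a + n * δ) (a + (n + 1) * δ)) := by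
        rw [Set.disjoint_left]
        rintro _ ⟨s, hs, rfl⟩ ⟨t, ht, hst⟩
        have := dpE_inj (a := a) (s := s) (t := t) ⟨hs.1, by nlinarith [hs.2]⟩
          ⟨by linarith [ht.1], by linarith [ht.2]⟩ hst.symm
        linarith [hs.2, ht.1]
      rw [hsplit, Set.image_union, measure_union hdis hmeas, add_mul, one_mul]
      have hsm := dp_arc_small (a := a + n * δ) (b := a + (n + 1) * δ) (by nlinarith) (by nlinarith)
      rw [show a + (n + 1) * δ - (a + n * δ) = δ by ring] at hsm
      exact add_le_add (ih (by nlinarith)) hsm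
  have hn : ∀ᶠ n : ℕ in Filter.atTop, ENNReal.ofReal (l - l ^ 3 / 16 * ((n : ℝ)⁻¹) ^ 2) ≤
      μH[1] (dpE '' Set.Icc a b) := by
    filter_upwards [Filter.eventually_gt_atTop 0, Filter.eventually_ge_atTop ⌈l⌉₊] with n hn0 hn1
    have hn0' : (0 : ℝ) < n := by exact_mod_cast hn0
    have hle : l ≤ n := Nat.ceil_le.1 hn1
    have hx : n * (l / n) = l := by field_simp
    have h1 := hsum n (l / n) (by positivity) (by rw [hx]; linarith)
    rw [hx] at h1
    refine le_trans ?_ (h1.trans (measure_mono (Set.image_mono ?_)))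
    · rw [← ENNReal.ofReal_natCast, ← ENNReal.ofReal_mul hn0'.le]
      refine ENNReal.ofReal_le_ofReal ?_
      rcases hl0.eq_or_lt with h0 | h0
      · simp [← h0]
      · have := Real.sin_gt_sub_cube (x := l / n / 2) (by positivity)
        have hcube : 0 ≤ (l / n / 2) ^ 3 := by positivity
        have e : n * (2 * (l / n / 2 - (l / n / 2) ^ 3 / 4)) = l - l ^ 3 / 16 * ((n : ℝ)⁻¹) ^ 2 := by
          field_simp
          ring
        rw [← e]
        exact mul_le_mul_of_nonneg_left (by linarith) hn0'.le
    · rw [hl, add_sub_cancel]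
      exact Set.Ico_subset_Icc_self
  refine le_of_tendsto ?_ hn
  have h0 : Filter.Tendsto (fun n : ℕ => l - l ^ 3 / 16 * ((n : ℝ)⁻¹) ^ 2) Filter.atTop
      (nhds (l - l ^ 3 / 16 * 0 ^ 2)) :=
    (((tendsto_inv_atTop_nhds_zero_nat (𝕜 := ℝ)).pow 2).const_mul _).const_sub _
  have h1 := (ENNReal.continuous_ofReal.tendsto _).comp h0
  simpa [Function.comp_def] using h1

/-- A connected set joining two parts of the circle is long off the circle. -/
lemma dp_bridge {C P Q : Set ℂ} (hC : IsPreconnected C) (hP : P ⊆ C) (hQ : Q ⊆ C)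
    (hPn : P.Nonempty) (hQn : Q.Nonempty) (hs : C ∩ sphere 0 1 ⊆ P ∪ Q) {d : ℝ}
    (hd : ∀ x ∈ P, ∀ y ∈ Q, d ≤ dist x y) :
    ENNReal.ofReal d ≤ μH[1] (C \ sphere 0 1) := by
  obtain ⟨p, hp⟩ := hPn
  obtain ⟨q, hq⟩ := hQn
  have hlow : ∀ y ∈ Q, d ≤ infDist y P := fun y hy =>
    (le_infDist ⟨p, hp⟩).2 (fun x hx => by rw [dist_comm]; exact hd x hx y hy)
  refine dp_lip_le (f := fun z => infDist z P) (lipschitz_infDist_pt P) ?_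
  intro r hr
  have := hC.intermediate_value (hP hp) (hQ hq) (f := fun z => infDist z P)
    (continuous_infDist_pt P).continuousOn
  obtain ⟨z, hz, hzr⟩ := this (show r ∈ Set.Icc (infDist p P) (infDist q P) from
    ⟨by rw [infDist_zero_of_mem hp]; exact hr.1.le, hr.2.le.trans (hlow q hq)⟩)
  refine ⟨z, ⟨hz, fun hzs => ?_⟩, hzr⟩
  simp only at hzr
  rcases hs ⟨hz, hzs⟩ with h | h
  · rw [infDist_zero_of_mem h] at hzr
    linarith [hr.1]
  · linarith [hlow z h, hr.2]

lemma dp_ineq {x : ℝ} (h1 : Real.pi ≤ x) (h2 : x ≤ 2 * Real.pi) :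
    Real.pi + 2 ≤ x + 2 * Real.sin (x / 2) := by
  have e : Real.sin (x / 2) = Real.cos ((x - Real.pi) / 2) := by
    rw [show x / 2 = (x - Real.pi) / 2 + Real.pi / 2 by ring, Real.sin_add_pi_div_two]
  have := Real.one_sub_sq_div_two_le_cos (x := (x - Real.pi) / 2)
  rw [e]
  nlinarith [Real.pi_lt_four]


lemma dp_final {X C : Set ℂ} {a b : ℝ} (h1 : Real.pi ≤ b - a) (h2 : b - a ≤ 2 * Real.pi)
    (hX : dpE '' Set.Icc a b ⊆ X) (hC : C \ sphere 0 1 ⊆ X)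
    (hm : ENNReal.ofReal (2 * Real.sin ((b - a) / 2)) ≤ μH[1] (C \ sphere 0 1)) :
    ENNReal.ofReal (Real.pi + 2) ≤ μH[1] X := by
  have hp := Real.pi_pos
  have hmeas : MeasurableSet (dpE '' Set.Icc a b) :=
    (isCompact_Icc.image dpE_cont).measurableSet
  have hdis : Disjoint (C \ sphere 0 1) (dpE '' Set.Icc a b) := by
    rw [Set.disjoint_left]
    rintro _ ⟨-, hn⟩ ⟨t, -, rfl⟩
    exact hn (by simp [dpE_norm])
  calc ENNReal.ofReal (Real.pi + 2)
      ≤ ENNReal.ofReal (2 * Real.sin ((b - a) / 2) + (b - a)) :=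
        ENNReal.ofReal_le_ofReal (by linarith [dp_ineq h1 h2])
    _ ≤ ENNReal.ofReal (2 * Real.sin ((b - a) / 2)) + ENNReal.ofReal (b - a) :=
        ENNReal.ofReal_add_le
    _ ≤ μH[1] (C \ sphere 0 1) + μH[1] (dpE '' Set.Icc a b) :=
        add_le_add hm (dp_arc_ge (by linarith) (by linarith))
    _ = μH[1] (C \ sphere 0 1 ∪ dpE '' Set.Icc a b) := (measure_union hdis hmeas).symm
    _ ≤ μH[1] X := measure_mono (Set.union_subset hC hX)

lemma dp_full {X : Set ℂ} (hX : ∀ t, dpE t ∈ X) :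
    ENNReal.ofReal (Real.pi + 2) ≤ μH[1] X := by
  refine dp_final (C := ∅) (a := 0) (b := 2 * Real.pi) (by linarith [Real.pi_pos]) (by simp)
    (by rintro _ ⟨t, -, rfl⟩; exact hX t) (by simp) (by simp)

/-- The core estimate for closed regions. -/
lemma dp_core {K L X Y : Set ℂ} (eK : K ≃ₜ closedBall (0 : ℂ) 1) (eL : L ≃ₜ closedBall (0 : ℂ) 1)
    (hU : K ∪ L = closedBall 0 1) (hX1 : K ∩ L ⊆ X) (hX2 : K ∩ sphere 0 1 ⊆ X)
    (hY1 : K ∩ L ⊆ Y) (hY2 : L ∩ sphere 0 1 ⊆ Y) :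
    ENNReal.ofReal (Real.pi + 2) ≤ max (μH[1] X) (μH[1] Y) := by
  have hp := Real.pi_pos
  obtain ⟨hKc, hKp, U, hUo, hUp, hUK, hKU⟩ := dp_disk eK
  obtain ⟨hLc, hLp, V, hVo, hVp, hVL, hLV⟩ := dp_disk eL
  have hE : ∀ t, dpE t ∈ sphere (0 : ℂ) 1 := fun t => by simp [dpE_norm]
  have hKL : ∀ t, dpE t ∈ K ∨ dpE t ∈ L := fun t => by
    have : dpE t ∈ K ∪ L := hU ▸ sphere_subset_closedBall (hE t)
    exact this
  by_cases hKs : ∀ t, dpE t ∈ K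
  · exact le_max_of_le_left (dp_full fun t => hX2 ⟨hKs t, hE t⟩)
  by_cases hLs : ∀ t, dpE t ∈ L
  · exact le_max_of_le_right (dp_full fun t => hY2 ⟨hLs t, hE t⟩)
  push Not at hKs hLs
  by_cases hfin : μH[1] (K ∩ L) = ⊤
  · refine le_max_of_le_left (le_trans ?_ (measure_mono hX1))
    rw [hfin]; exact le_top
  have hUV : Disjoint U V := by
    rw [Set.disjoint_left]
    intro x hxU hxV
    have hn : K ∩ L ∈ nhds x := Filter.mem_of_superset
      ((hUo.inter hVo).mem_nhds ⟨hxU, hxV⟩) (Set.inter_subset_inter hUK hVL)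
    have h1 := Real.dimH_of_mem_nhds hn
    have h2 := dimH_le_of_hausdorffMeasure_ne_top (d := 1) (s := K ∩ L) (by simpa using hfin)
    rw [h1, Complex.finrank_real_complex] at h2
    norm_num at h2
  have hC := dp_unicoherent hKc.isClosed hLc.isClosed hKp hLp hU
  -- the two non-alternation statements
  have sepK : ∀ {t1 t2 t3 t4 : ℝ}, t1 < t2 → t2 < t3 → t3 < t4 → t4 < t1 + 2 * Real.pi →
      dpE t1 ∉ L → dpE t3 ∉ L → dpE t2 ∈ L → dpE t4 ∈ L → False :=
    fun h12 h23 h34 h41 => dp_sep hLc.isClosed hU hUo hUp hUK hKU hVp hVL hLV hUV h12 h23 h34 h41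
  have sepL : ∀ {t1 t2 t3 t4 : ℝ}, t1 < t2 → t2 < t3 → t3 < t4 → t4 < t1 + 2 * Real.pi →
      dpE t1 ∉ K → dpE t3 ∉ K → dpE t2 ∈ K → dpE t4 ∈ K → False :=
    fun h12 h23 h34 h41 => dp_sep hKc.isClosed (by rw [Set.union_comm]; exact hU)
      hVo hVp hVL hLV hUp hUK hKU hUV.symm h12 h23 h34 h41
  obtain ⟨t0, ht0⟩ := hKs
  obtain ⟨r0, hr0⟩ := hLs
  obtain ⟨r, hr, hrE⟩ := dpE_surj t0 (dpE_norm r0)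
  rw [← hrE] at hr0
  have hrK : dpE r ∈ K := (hKL r).resolve_right hr0
  have ht0L : dpE t0 ∈ L := (hKL t0).resolve_left ht0
  have ht0' : dpE (t0 + 2 * Real.pi) ∉ K := by rwa [dpE_add_two_pi]
  have ht0L' : dpE (t0 + 2 * Real.pi) ∈ L := by rwa [dpE_add_two_pi]
  have clK : IsClosed {t | dpE t ∈ K} := hKc.isClosed.preimage dpE_cont
  have clL : IsClosed {t | dpE t ∈ L} := hLc.isClosed.preimage dpE_cont
  have ltr : t0 < r := lt_of_le_of_ne hr.1 (fun h => ht0 (h ▸ hrK))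
  -- extreme points of `K` on the circle
  obtain ⟨b1, hb1⟩ := ((isCompact_Icc (a := t0) (b := r)).inter_right clK).exists_isLeast
    ⟨r, ⟨hr.1, le_rfl⟩, hrK⟩
  obtain ⟨b2, hb2⟩ := ((isCompact_Icc (a := r) (b := t0 + 2 * Real.pi)).inter_right
    clK).exists_isGreatest ⟨r, ⟨le_rfl, hr.2.le⟩, hrK⟩
  have hb1K : dpE b1 ∈ K := hb1.1.2
  have hb2K : dpE b2 ∈ K := hb2.1.2
  have tb1 : t0 < b1 := lt_of_le_of_ne hb1.1.1.1 (fun h => ht0 (h ▸ hb1K))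
  have tb2 : b2 < t0 + 2 * Real.pi := lt_of_le_of_ne hb2.1.1.2 (fun h => ht0' (h ▸ hb2K))
  have out1 : ∀ t, t0 ≤ t → t < b1 → dpE t ∉ K := fun t h1 h2 h3 =>
    absurd (hb1.2 ⟨⟨h1, h2.le.trans hb1.1.1.2⟩, h3⟩) (not_le.2 h2)
  have out2 : ∀ t, b2 < t → t ≤ t0 + 2 * Real.pi → dpE t ∉ K := fun t h1 h2 h3 =>
    absurd (hb2.2 ⟨⟨hb2.1.1.1.trans h1.le, h2⟩, h3⟩) (not_le.2 h1)
  have hb1L : dpE b1 ∈ L := by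
    have : b1 ∈ closure (Set.Ioo t0 b1) := by
      rw [closure_Ioo tb1.ne]; exact ⟨tb1.le, le_rfl⟩
    exact clL.closure_subset_iff.2
      (fun t ht => (hKL t).resolve_left (out1 t ht.1.le ht.2)) this
  have hb2L : dpE b2 ∈ L := by
    have : b2 ∈ closure (Set.Ioo b2 (t0 + 2 * Real.pi)) := by
      rw [closure_Ioo tb2.ne]; exact ⟨le_rfl, tb2.le⟩
    exact clL.closure_subset_iff.2
      (fun t ht => (hKL t).resolve_left (out2 t ht.1 ht.2.le)) this
  have arcK : ∀ t, b1 ≤ t → t ≤ b2 → dpE t ∈ K := by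
    intro t h1 h2
    by_contra hn
    have h1' : b1 < t := lt_of_le_of_ne h1 (fun h => hn (h ▸ hb1K))
    have h2' : t < b2 := lt_of_le_of_ne h2 (fun h => hn (h ▸ hb2K))
    exact sepL tb1 h1' h2' tb2 ht0 hn hb1K hb2K
  obtain ⟨p1, hp1⟩ := ((isCompact_Icc (a := b1) (b := r)).inter_right clL).exists_isGreatest
    ⟨b1, ⟨le_rfl, hb1.1.1.2⟩, hb1L⟩
  obtain ⟨p2, hp2⟩ := ((isCompact_Icc (a := r) (b := b2)).inter_right clL).exists_isLeast
    ⟨b2, ⟨hb2.1.1.1, le_rfl⟩, hb2L⟩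
  have hp1L : dpE p1 ∈ L := hp1.1.2
  have hp2L : dpE p2 ∈ L := hp2.1.2
  have pr1 : p1 < r := lt_of_le_of_ne hp1.1.1.2 (fun h => hr0 (h ▸ hp1L))
  have pr2 : r < p2 := lt_of_le_of_ne hp2.1.1.1 (fun h => hr0 (h ▸ hp2L))
  have bp1 : b1 ≤ p1 := hp1.1.1.1
  have bp2 : p2 ≤ b2 := hp2.1.1.2
  have mid : ∀ t, p1 < t → t < p2 → dpE t ∉ L := by
    intro t h1 h2 h3
    rcases le_total t r with h | h
    · exact absurd (hp1.2 ⟨⟨bp1.trans h1.le, h⟩, h3⟩) (not_le.2 h1)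
    · exact absurd (hp2.2 ⟨⟨h, h2.le.trans bp2⟩, h3⟩) (not_le.2 h2)
  have arcL1 : ∀ t, b1 ≤ t → t ≤ p1 → dpE t ∈ L := by
    intro t h1 h2
    by_contra hn
    have h2' : t < p1 := lt_of_le_of_ne h2 (fun h => hn (h ▸ hp1L))
    exact sepK h2' pr1 hr.2 (by linarith) hn hr0 hp1L ht0L'
  have arcL2 : ∀ t, p2 ≤ t → t ≤ b2 → dpE t ∈ L := by
    intro t h1 h2
    by_contra hn
    have h1' : p2 < t := lt_of_le_of_ne h1 (fun h => hn (h ▸ hp2L))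
    exact sepK pr2 h1' (t4 := t0 + 2 * Real.pi) (by linarith) (by linarith) hr0 hn hp2L ht0L'
  obtain ⟨⟨p, q⟩, ⟨hpP, hqQ⟩, hmin⟩ :=
    ((isCompact_Icc (a := b1) (b := p1)).prod (isCompact_Icc (a := p2) (b := b2))).exists_isMinOn
    ⟨(b1, b2), ⟨le_rfl, bp1⟩, ⟨bp2, le_rfl⟩⟩ (f := fun s : ℝ × ℝ => dist (dpE s.1) (dpE s.2))
    (by have := dpE_cont; fun_prop)
  simp only at hpP hqQ
  have hpq : p < q := by linarith [hpP.2, hqQ.1]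
  have hqp : q < p + 2 * Real.pi := by linarith [hpP.1, hqQ.2]
  have hbr := dp_bridge (P := dpE '' Set.Icc b1 p1) (Q := dpE '' Set.Icc p2 b2)
    (d := dist (dpE p) (dpE q)) hC
    (by rintro _ ⟨t, ht, rfl⟩; exact ⟨arcK t ht.1 (by linarith [ht.2]), arcL1 t ht.1 ht.2⟩)
    (by rintro _ ⟨t, ht, rfl⟩; exact ⟨arcK t (by linarith [ht.1]) ht.2, arcL2 t ht.1 ht.2⟩)
    ⟨_, b1, ⟨le_rfl, bp1⟩, rfl⟩ ⟨_, b2, ⟨bp2, le_rfl⟩, rfl⟩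
    (by
      rintro z ⟨⟨hzK, hzL⟩, hz⟩
      obtain ⟨t, ht, rfl⟩ := dpE_surj t0 (z := z) (by simpa using hz)
      have h1 : b1 ≤ t := by
        by_contra h; exact out1 t ht.1 (not_le.1 h) hzK
      have h2 : t ≤ b2 := by
        by_contra h; exact out2 t (not_le.1 h) ht.2.le hzK
      rcases le_or_gt t p1 with h3 | h3
      · exact Or.inl ⟨t, ⟨h1, h3⟩, rfl⟩
      rcases le_or_gt p2 t with h4 | h4
      · exact Or.inr ⟨t, ⟨h4, h2⟩, rfl⟩
      · exact absurd hzL (mid t h3 h4))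
    (by
      rintro _ ⟨s, hs, rfl⟩ _ ⟨t, ht, rfl⟩
      exact hmin (show (s, t) ∈ Set.Icc b1 p1 ×ˢ Set.Icc p2 b2 from ⟨hs, ht⟩))
  rw [dist_eq_norm, dp_dist p q hpq.le hqp.le] at hbr
  rcases le_total Real.pi (q - p) with hlong | hshort
  · refine le_max_of_le_left (dp_final (C := K ∩ L) hlong (by linarith) ?_ ?_ hbr)
    · rintro _ ⟨t, ht, rfl⟩
      exact hX2 ⟨arcK t (by linarith [ht.1, hpP.1]) (by linarith [ht.2, hqQ.2]), hE t⟩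
    · exact Set.sdiff_subset.trans hX1
  · refine le_max_of_le_right (dp_final (C := K ∩ L) (a := q) (b := p + 2 * Real.pi)
      (by linarith) (by linarith) ?_ (Set.sdiff_subset.trans hY1) ?_)
    · rintro _ ⟨t, ht, rfl⟩
      refine hY2 ⟨?_, hE t⟩
      rcases le_total t b2 with h1 | h1
      · exact arcL2 t (by linarith [ht.1, hqQ.1]) h1
      rcases le_total t (t0 + 2 * Real.pi) with h2 | h2
      · rcases h1.eq_or_lt with h3 | h3
        · rw [← h3]; exact hb2L
        · exact (hKL t).resolve_left (out2 t h3 h2)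
      · have e : dpE t = dpE (t - 2 * Real.pi) := by
          rw [← dpE_add_two_pi (t - 2 * Real.pi)]; congr 1; ring
        rw [e]
        rcases lt_or_ge (t - 2 * Real.pi) b1 with h3 | h3
        · exact (hKL _).resolve_left (out1 _ (by linarith) h3)
        · exact arcL1 _ h3 (by linarith [ht.2, hpP.2])
    · rw [show (p + 2 * Real.pi - q) / 2 = Real.pi - (q - p) / 2 by ring, Real.sin_pi_sub]
      exact hbr

lemma dp_frontier {A B : Set ℂ} (hU : A ∪ B = closedBall 0 1) (hd : Disjoint A B) :
    closure A ∩ closure B ⊆ frontier A ∧ closure A ∩ sphere 0 1 ⊆ frontier A := by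
  rw [frontier_eq_closure_inter_closure]
  constructor
  · exact Set.inter_subset_inter_right _ (closure_mono hd.subset_compl_left)
  · refine Set.inter_subset_inter_right _ ?_
    have h1 : (closedBall (0 : ℂ) 1)ᶜ ⊆ Aᶜ :=
      Set.compl_subset_compl.2 (hU ▸ Set.subset_union_left)
    refine subset_trans ?_ (closure_mono h1)
    rw [closure_compl, interior_closedBall _ one_ne_zero]
    intro z hz
    simp at hz ⊢
    exact hz.ge

lemma dp_main {A B : Set ℂ} (hU : A ∪ B = closedBall 0 1) (hd : Disjoint A B)
    (eA : closure A ≃ₜ closedBall (0 : ℂ) 1) (eB : closure B ≃ₜ closedBall (0 : ℂ) 1) :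
    ENNReal.ofReal (Real.pi + 2) ≤ max (μH[1] (frontier A)) (μH[1] (frontier B)) := by
  obtain ⟨h1, h2⟩ := dp_frontier hU hd
  obtain ⟨h3, h4⟩ := dp_frontier (by rw [Set.union_comm]; exact hU) hd.symm
  refine dp_core eA eB ?_ h1 h2 (by rw [Set.inter_comm]; exact h3) h4
  rw [← closure_union, hU, isClosed_closedBall.closure_eq]


def dpLeft : Set ℂ := {z | ‖z‖ ≤ 1 ∧ z.re ≤ 0}
def dpRight : Set ℂ := {z | ‖z‖ ≤ 1 ∧ 0 < z.re}

lemma dpE_re (t : ℝ) : (dpE t).re = Real.cos t := by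
  simp [dpE, Complex.exp_ofReal_mul_I_re]

lemma dp_seg_mem {z : ℂ} (h : z.re = 0) (h1 : ‖z‖ ≤ 1) : z ∈ segment ℝ (-Complex.I) Complex.I := by
  have him : |z.im| ≤ 1 := (Complex.abs_im_le_norm z).trans h1
  rw [abs_le] at him
  refine ⟨(1 - z.im) / 2, (1 + z.im) / 2, by linarith, by linarith, by ring, ?_⟩
  apply Complex.ext
  · simp [h]
  · simp; ring

lemma dp_half_le {X : Set ℂ} {a : ℝ}
    (h : X ⊆ dpE '' Set.Icc a (a + Real.pi) ∪ segment ℝ (-Complex.I) Complex.I) :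
    μH[1] X ≤ ENNReal.ofReal (Real.pi + 2) := by
  have h2 : μH[1] (segment ℝ (-Complex.I) Complex.I) = ENNReal.ofReal 2 := by
    rw [hausdorffMeasure_segment, edist_dist, dist_eq_norm]
    congr 1
    have : -Complex.I - Complex.I = (-2 : ℂ) * Complex.I := by ring
    rw [this]; simp
  calc μH[1] X ≤ _ := measure_mono h
    _ ≤ _ := measure_union_le _ _
    _ ≤ ENNReal.ofReal Real.pi + ENNReal.ofReal 2 := by
        refine add_le_add ?_ h2.le
        simpa using dp_arc_le a (a + Real.pi)
    _ = _ := (ENNReal.ofReal_add Real.pi_pos.le (by norm_num)).symm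

lemma dp_left_sub : frontier dpLeft ⊆
    dpE '' Set.Icc (Real.pi / 2) (Real.pi / 2 + Real.pi) ∪ segment ℝ (-Complex.I) Complex.I := by
  intro z hz
  have hc : z ∈ dpLeft := by
    have hcl : IsClosed dpLeft := (isClosed_le continuous_norm continuous_const).inter
      (isClosed_le Complex.continuous_re continuous_const)
    exact hcl.closure_eq ▸ hz.1
  have hi : ¬ (‖z‖ < 1 ∧ z.re < 0) := fun h => hz.2 (by
    have ho : IsOpen {z : ℂ | ‖z‖ < 1 ∧ z.re < 0} :=
      (isOpen_lt continuous_norm continuous_const).inter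
      (isOpen_lt Complex.continuous_re continuous_const)
    exact interior_maximal (s := dpLeft) (fun w (hw : ‖w‖ < 1 ∧ w.re < 0) => ⟨hw.1.le, hw.2.le⟩) ho h)
  by_cases h0 : z.re = 0
  · exact Or.inr (dp_seg_mem h0 hc.1)
  · left
    have hre : z.re < 0 := lt_of_le_of_ne hc.2 h0
    have hn : ‖z‖ = 1 := le_antisymm hc.1 (not_lt.1 fun h => hi ⟨h, hre⟩)
    obtain ⟨t, ht, rfl⟩ := dpE_surj (Real.pi / 2) hn
    refine ⟨t, ⟨ht.1, ?_⟩, rfl⟩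
    by_contra hlt
    rw [dpE_re, ← Real.cos_sub_two_pi] at hre
    have := Real.cos_pos_of_mem_Ioo (x := t - 2 * Real.pi)
      ⟨by linarith, by linarith [ht.2, Real.pi_pos]⟩
    linarith

lemma dp_right_sub : frontier dpRight ⊆
    dpE '' Set.Icc (-(Real.pi / 2)) (-(Real.pi / 2) + Real.pi)
      ∪ segment ℝ (-Complex.I) Complex.I := by
  intro z hz
  have hc : ‖z‖ ≤ 1 ∧ 0 ≤ z.re := by
    have hcl : IsClosed {z : ℂ | ‖z‖ ≤ 1 ∧ 0 ≤ z.re} :=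
      (isClosed_le continuous_norm continuous_const).inter
      (isClosed_le continuous_const Complex.continuous_re)
    exact closure_minimal (s := dpRight) (t := {z : ℂ | ‖z‖ ≤ 1 ∧ 0 ≤ z.re})
      (fun w (hw : ‖w‖ ≤ 1 ∧ 0 < w.re) => ⟨hw.1, hw.2.le⟩) hcl hz.1
  have hi : ¬ (‖z‖ < 1 ∧ 0 < z.re) := fun h => hz.2 (by
    have ho : IsOpen {z : ℂ | ‖z‖ < 1 ∧ 0 < z.re} :=
      (isOpen_lt continuous_norm continuous_const).inter
      (isOpen_lt continuous_const Complex.continuous_re)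
    exact interior_maximal (s := dpRight) (fun w (hw : ‖w‖ < 1 ∧ 0 < w.re) => ⟨hw.1.le, hw.2⟩) ho h)
  by_cases h0 : z.re = 0
  · exact Or.inr (dp_seg_mem h0 hc.1)
  · left
    have hre : 0 < z.re := lt_of_le_of_ne hc.2 (Ne.symm h0)
    have hn : ‖z‖ = 1 := le_antisymm hc.1 (not_lt.1 fun h => hi ⟨h, hre⟩)
    obtain ⟨t, ht, rfl⟩ := dpE_surj (-(Real.pi / 2)) hn
    refine ⟨t, ⟨ht.1, ?_⟩, rfl⟩
    by_contra hlt
    rw [dpE_re] at hre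
    have := Real.cos_neg_of_pi_div_two_lt_of_lt (x := t)
      (by linarith) (by linarith [ht.2, Real.pi_pos])
    linarith

lemma dp_left_ge : ENNReal.ofReal (Real.pi + 2) ≤ μH[1] (frontier dpLeft) := by
  have hU : dpLeft ∪ dpRight = closedBall 0 1 := by
    ext z
    simp only [dpLeft, dpRight, Set.mem_union, Set.mem_ofPred_eq, mem_closedBall, dist_zero_right]
    rcases le_or_gt z.re 0 with h | h <;> simp [h, not_lt.2, not_le.2]
  have hd : Disjoint dpLeft dpRight := Set.disjoint_left.2 fun z h1 h2 => absurd h1.2 (not_le.2 h2.2)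
  obtain ⟨hf1, hf2⟩ := dp_frontier hU hd
  have hpi := Real.pi_pos
  refine dp_final (X := frontier dpLeft) (C := {z : ℂ | z.re = 0 ∧ ‖z‖ ≤ 1})
    (a := Real.pi / 2) (b := Real.pi / 2 + Real.pi) (by linarith) (by linarith) ?_ ?_ ?_
  · rintro _ ⟨t, ht, rfl⟩
    refine hf2 ⟨subset_closure ⟨(dpE_norm t).le, ?_⟩, by simp [dpE_norm]⟩
    rw [dpE_re]
    exact Real.cos_nonpos_of_pi_div_two_le_of_le ht.1 (by linarith [ht.2])
  · rintro z ⟨⟨h0, h1⟩, h2⟩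
    have h3 : ‖z‖ < 1 := lt_of_le_of_ne h1 (by simpa using h2)
    refine hf1 ⟨subset_closure ⟨h1, h0.le⟩, ?_⟩
    rw [Metric.mem_closure_iff]
    intro ε hε
    have hδ : 0 < min (ε / 2) (1 - ‖z‖) := lt_min (by linarith) (by linarith)
    have hδ1 := min_le_left (ε / 2) (1 - ‖z‖)
    have hδ2 := min_le_right (ε / 2) (1 - ‖z‖)
    set δ := min (ε / 2) (1 - ‖z‖)
    have hn : ‖(δ : ℂ)‖ = δ := by simp [abs_of_pos hδ]
    refine ⟨z + δ, ⟨?_, ?_⟩, ?_⟩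
    · have := norm_add_le z (δ : ℂ)
      rw [hn] at this
      linarith
    · simp [h0, hδ]
    · rw [dist_comm, dist_eq_norm, add_sub_cancel_left, hn]
      linarith
  · have hs : (Real.pi / 2 + Real.pi - Real.pi / 2) / 2 = Real.pi / 2 := by ring
    rw [hs, Real.sin_pi_div_two, mul_one]
    refine dp_lip_le (f := fun z : ℂ => z.im + 1) ?_ ?_
    · refine LipschitzWith.of_dist_le_mul fun z w => ?_
      simp only [NNReal.coe_one, one_mul, Real.dist_eq, dist_eq_norm]
      have := Complex.abs_im_le_norm (z - w)
      simpa using this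
    · intro s hs
      have : ‖((s - 1 : ℝ) : ℂ) * Complex.I‖ < 1 := by
        rw [norm_mul, Complex.norm_I, mul_one, Complex.norm_real, Real.norm_eq_abs, abs_lt]
        constructor <;> linarith [hs.1, hs.2]
      refine ⟨((s - 1 : ℝ) : ℂ) * Complex.I, ⟨⟨by simp, this.le⟩, ?_⟩, by simp⟩
      intro h
      rw [mem_sphere_zero_iff_norm] at h
      linarith

lemma dp_halves : max (μH[1] (frontier dpLeft)) (μH[1] (frontier dpRight)) =
    ENNReal.ofReal (Real.pi + 2) :=
  le_antisymm (max_le (dp_half_le dp_left_sub) (dp_half_le dp_right_sub))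
    (dp_left_ge.trans (le_max_left _ _))

/-- The standard isometry from `ℂ` to the Euclidean plane. -/
def dpPhi : ℂ ≃ₗᵢ[ℝ] EuclideanSpace ℝ (Fin 2) := Complex.orthonormalBasisOneI.repr

lemma dpPhi_zero (z : ℂ) : dpPhi z 0 = z.re := by
  simp [dpPhi, Complex.orthonormalBasisOneI_repr_apply]

lemma dpPhi_frontier (A : Set (EuclideanSpace ℝ (Fin 2))) :
    μH[1] (frontier (dpPhi ⁻¹' A)) = μH[1] (frontier A) := by
  have h : frontier (dpPhi ⁻¹' A) = dpPhi.toIsometryEquiv ⁻¹' frontier A :=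
    (dpPhi.toHomeomorph.preimage_frontier A).symm
  rw [h, IsometryEquiv.hausdorffMeasure_preimage]

lemma dpPhi_ball : dpPhi ⁻¹' unitDisk = closedBall 0 1 := by
  ext z; simp [unitDisk]

lemma dpPhi_homeo (A : Set (EuclideanSpace ℝ (Fin 2))) (e : closure A ≃ₜ unitDisk) :
    Nonempty (closure (dpPhi ⁻¹' A) ≃ₜ closedBall (0 : ℂ) 1) := by
  have h1 : closure (dpPhi ⁻¹' A) = dpPhi.toHomeomorph ⁻¹' closure A :=
    (dpPhi.toHomeomorph.preimage_closure A).symm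
  have f1 : (dpPhi.toHomeomorph ⁻¹' closure A : Set ℂ) ≃ₜ closure A :=
    dpPhi.toHomeomorph.subtype fun _ => Iff.rfl
  have f2 : (dpPhi ⁻¹' unitDisk : Set ℂ) ≃ₜ unitDisk :=
    dpPhi.toHomeomorph.subtype fun _ => Iff.rfl
  exact ⟨(Homeomorph.setCongr h1).trans <| f1.trans <| e.trans <|
    f2.symm.trans (Homeomorph.setCongr dpPhi_ball)⟩


/-- Partition the closed unit disk `D` into two regions `A`, `B` whose closures are
homeomorphic to `D`.  Then the larger of the two boundary lengths (1-dimensional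
Hausdorff measures) is at least `π + 2`, with equality achieved by complementary
half-disks. -/
theorem boundary_length_of_disk_partition :
    (∀ A B : Set (EuclideanSpace ℝ (Fin 2)),
      A ∪ B = unitDisk → Disjoint A B →
      Nonempty (closure A ≃ₜ unitDisk) → Nonempty (closure B ≃ₜ unitDisk) →
      ENNReal.ofReal (Real.pi + 2) ≤
        max (μH[1] (frontier A)) (μH[1] (frontier B))) ∧
    max (μH[1] (frontier leftHalf)) (μH[1] (frontier rightHalf)) =
      ENNReal.ofReal (Real.pi + 2) := by
  refine ⟨fun A B hU hd ⟨eA⟩ ⟨eB⟩ => ?_, ?_⟩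
  · obtain ⟨fA⟩ := dpPhi_homeo A eA
    obtain ⟨fB⟩ := dpPhi_homeo B eB
    have h := dp_main (A := dpPhi ⁻¹' A) (B := dpPhi ⁻¹' B)
      (by rw [← Set.preimage_union, hU, dpPhi_ball]) (hd.preimage _) fA fB
    rwa [dpPhi_frontier, dpPhi_frontier] at h
  · have hL : dpPhi ⁻¹' leftHalf = dpLeft := by
      ext z; simp [leftHalf, dpLeft, dpPhi_zero]
    have hR : dpPhi ⁻¹' rightHalf = dpRight := by
      ext z; simp [rightHalf, dpRight, dpPhi_zero]
    rw [← dpPhi_frontier leftHalf, ← dpPhi_frontier rightHalf, hL, hR]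
    exact dp_halves

end
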